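/- arXiv:1405.3907 — 2 statements merged into one kernel-verified Lean document; each statement's English description precedes it below -/
import Mathlib

section
/- There exists an absolute constant c > 0 such that the following holds. Let w : 𝒳 → ℝ₊ be measurable and define ‖g‖_w² = ∫ g² w dμ. Let f_1,…,f_M ∈ L²(μ) and let f be a probability density with respect to μ, and assume ‖wf‖_∞ ≤ L and ‖w f_j‖_∞ ≤ L_0 for all j. Let θ̂ ∈ argmin_{θ∈Λ^M} V_n(θ) where V_n(θ) = ‖f_θ‖_w² − (2/n)Σ_{i=1}^n f_θ(X_i)·w(X_i) + (1/2)·Σ_{j=1}^M θ_j·‖f_j − f_θ‖_w². Then for any x > 0, with probability greater than 1 − exp(−x) over the n i.i.d. observations with density f, ‖f_θ̂ − f‖_w² ≤ min_{j=1,…,M} ‖f_j − f‖_w² + c·(L + L_0)·(x + log M)/n. -/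
open MeasureTheory Real

/-- The joint law of `n` i.i.d. observations drawn from the density `f` w.r.t. `μ`. -/
noncomputable def iidLaw {𝒳 : Type*} [MeasurableSpace 𝒳] (μ : Measure 𝒳) (n : ℕ)
    (f : 𝒳 → ℝ) : Measure (Fin n → 𝒳) :=
  Measure.pi fun _ : Fin n => μ.withDensity fun t => ENNReal.ofReal (f t)

/-- The convex combination `f_θ = ∑ⱼ θⱼ fⱼ`. -/
def combo {𝒳 : Type*} {M : ℕ} (fs : Fin M → 𝒳 → ℝ) (θ : Fin M → ℝ) : 𝒳 → ℝ :=
  fun t => ∑ j, θ j * fs j t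

/-- The weighted empirical objective
`V_n(θ) = ‖f_θ‖_w² − (2/n)∑ᵢ f_θ(Xᵢ)w(Xᵢ) + (1/2)∑ⱼ θⱼ ‖fⱼ − f_θ‖_w²`. -/
noncomputable def Vw {𝒳 : Type*} [MeasurableSpace 𝒳] (μ : Measure 𝒳) {M n : ℕ}
    (w : 𝒳 → ℝ) (fs : Fin M → 𝒳 → ℝ) (ω : Fin n → 𝒳) (θ : Fin M → ℝ) : ℝ :=
  (∫ t, combo fs θ t ^ 2 * w t ∂μ)
    - (2 / (n : ℝ)) * ∑ i, combo fs θ (ω i) * w (ω i)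
    + (1 / 2) * ∑ j, θ j * ∫ t, (fs j t - combo fs θ t) ^ 2 * w t ∂μ

/-- Chernoff bound for the sum of `n` i.i.d. copies of an a.s. bounded variable. -/
lemma measure_pi_le_mul_sum_le {𝒳 : Type*} [MeasurableSpace 𝒳] {ν : Measure 𝒳}
    [IsProbabilityMeasure ν] {Y : 𝒳 → ℝ} (hY : Measurable Y) {b v l : ℝ}
    (hb : ∀ᵐ t ∂ν, |Y t| ≤ b) (hl : 0 ≤ l) (hlb : l * b ≤ 1) (hv : ∫ t, Y t ^ 2 ∂ν ≤ v)
    (n : ℕ) (s : ℝ) :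
    (Measure.pi fun _ : Fin n => ν) {ω | s ≤ l * ∑ i, Y (ω i)} ≤
      ENNReal.ofReal (exp (n * (l * ∫ t, Y t ∂ν + l ^ 2 * v) - s)) := by
  have hYi : Integrable Y ν := Integrable.of_bound hY.aestronglyMeasurable b (by simpa using hb)
  have hY2 : Integrable (fun t => Y t ^ 2) ν :=
    Integrable.of_bound (hY.pow_const 2).aestronglyMeasurable (b ^ 2) (by
      filter_upwards [hb] with t ht
      rw [norm_pow, Real.norm_eq_abs]
      gcongr)
  have hbound : ∀ᵐ t ∂ν, exp (l * Y t) ≤ 1 + l * Y t + l ^ 2 * Y t ^ 2 := by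
    filter_upwards [hb] with t ht
    have h1 : |l * Y t| ≤ 1 := by
      rw [abs_mul, abs_of_nonneg hl]
      exact (mul_le_mul_of_nonneg_left ht hl).trans hlb
    have h2 := (abs_le.1 (abs_exp_sub_one_sub_id_le h1)).2
    nlinarith
  have hexp : Integrable (fun t => exp (l * Y t)) ν := by
    refine Integrable.of_bound (hY.const_mul l).exp.aestronglyMeasurable (exp 1) ?_
    filter_upwards [hb] with t ht
    rw [Real.norm_eq_abs, abs_of_pos (exp_pos _)]
    exact exp_le_exp.2 ((mul_le_mul_of_nonneg_left ((le_abs_self _).trans ht) hl).trans hlb)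
  have hmgf : ∫ t, exp (l * Y t) ∂ν ≤ exp (l * ∫ t, Y t ∂ν + l ^ 2 * v) := by
    have hi1 : Integrable (fun t => 1 + l * Y t) ν := (integrable_const _).add (hYi.const_mul l)
    calc ∫ t, exp (l * Y t) ∂ν
        ≤ ∫ t, (1 + l * Y t + l ^ 2 * Y t ^ 2) ∂ν :=
          integral_mono_ae hexp (hi1.add (hY2.const_mul _)) hbound
      _ = 1 + l * ∫ t, Y t ∂ν + l ^ 2 * ∫ t, Y t ^ 2 ∂ν := by
          rw [integral_add hi1 (hY2.const_mul _),
            integral_add (integrable_const _) (hYi.const_mul l), integral_const_mul,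
            integral_const_mul]
          simp
      _ ≤ (l * ∫ t, Y t ∂ν + l ^ 2 * v) + 1 := by nlinarith [sq_nonneg l]
      _ ≤ _ := add_one_le_exp _
  have hprod : Integrable (fun ω : Fin n → 𝒳 => ∏ i, exp (l * Y (ω i)))
      (Measure.pi fun _ : Fin n => ν) := Integrable.fintype_prod fun _ => hexp
  have hmarkov := mul_meas_ge_le_integral_of_nonneg
    (ae_of_all _ fun ω => Finset.prod_nonneg fun i _ => (exp_pos (l * Y (ω i))).le) hprod (exp s)
  rw [integral_fintype_prod_eq_pow (fun t => exp (l * Y t)), Fintype.card_fin] at hmarkov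
  have hset : {ω : Fin n → 𝒳 | exp s ≤ ∏ i, exp (l * Y (ω i))}
      = {ω | s ≤ l * ∑ i, Y (ω i)} := by
    ext ω
    simp only [Set.mem_ofPred_eq]
    rw [← exp_sum, exp_le_exp, Finset.mul_sum]
  rw [hset] at hmarkov
  have hpow : (∫ t, exp (l * Y t) ∂ν) ^ n ≤ exp (n * (l * ∫ t, Y t ∂ν + l ^ 2 * v)) := by
    rw [exp_nat_mul]
    exact pow_le_pow_left₀ (integral_nonneg fun _ => (exp_pos _).le) hmgf n
  rw [← ofReal_measureReal]
  apply ENNReal.ofReal_le_ofReal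
  rw [exp_sub, le_div_iff₀ (exp_pos s), mul_comm]
  exact hmarkov.trans hpow

/-- Averaging a quadratic form around a point `c` with weights `θ` summing to one. -/
lemma sum_mul_bilin_single_sub {M : ℕ} (B : LinearMap.BilinForm ℝ (Fin M → ℝ))
    (hB : ∀ a b, B a b = B b a) (θ c : Fin M → ℝ) (hθ : ∑ j, θ j = 1) :
    ∑ j, θ j * B (Pi.single j 1 - c) (Pi.single j 1 - c)
      = ∑ j, θ j * B (Pi.single j 1) (Pi.single j 1) - 2 * B θ c + B c c := by
  have h1 : B θ c = ∑ j, θ j * B (Pi.single j 1) c := by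
    conv_lhs => rw [pi_eq_sum_univ' θ]
    simp
  have h2 : ∀ j, θ j * B (Pi.single j 1 - c) (Pi.single j 1 - c)
      = θ j * B (Pi.single j 1) (Pi.single j 1) - 2 * (θ j * B (Pi.single j 1) c)
        + θ j * B c c := by
    intro j
    simp only [map_sub, LinearMap.sub_apply, hB c]
    ring
  simp_rw [h2]
  rw [Finset.sum_add_distrib, Finset.sum_sub_distrib, ← Finset.mul_sum, ← Finset.sum_mul, hθ, h1]
  ring

/-- Curvature inequality for minimizers over the simplex of the penalized quadratic objective. -/
lemma penalized_minimizer_le_vertex {M : ℕ} (B : LinearMap.BilinForm ℝ (Fin M → ℝ))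
    (hB : ∀ a b, B a b = B b a) (r θ : Fin M → ℝ)
    (hθ : θ ∈ stdSimplex ℝ (Fin M))
    (hmin : ∀ η ∈ stdSimplex ℝ (Fin M),
      B θ θ - ∑ j, θ j * r j
          + 1 / 2 * ∑ j, θ j * B (Pi.single j 1 - θ) (Pi.single j 1 - θ)
        ≤ B η η - ∑ j, η j * r j
          + 1 / 2 * ∑ j, η j * B (Pi.single j 1 - η) (Pi.single j 1 - η))
    (k : Fin M) :
    B θ θ - ∑ j, θ j * r j - (B (Pi.single k 1) (Pi.single k 1) - r k)
      ≤ -(1 / 2 * ∑ j, θ j *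
          B (Pi.single j 1 - Pi.single k 1) (Pi.single j 1 - Pi.single k 1)) := by
  set e : Fin M → ℝ := Pi.single k 1 with he
  have hek : e ∈ stdSimplex ℝ (Fin M) := single_mem_stdSimplex ℝ k
  set d : Fin M → ℝ := fun j => B (Pi.single j 1) (Pi.single j 1) with hd
  have hsum : ∀ g : Fin M → ℝ, ∑ j, e j * g j = g k := by
    intro g
    simp [he, Pi.single_apply]
  rw [sum_mul_bilin_single_sub B hB θ e hθ.2]
  set D : ℝ := B θ θ - 2 * B θ e + B e e with hD
  set A : ℝ := (B e e - r k) - (B θ θ / 2 - ∑ j, θ j * r j + 1 / 2 * ∑ j, θ j * d j) with hA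
  have key : ∀ t : ℝ, 0 < t → t ≤ 1 → 1 / 2 * D - t / 2 * D ≤ A := by
    intro t ht ht1
    have hη : (1 - t) • θ + t • e ∈ stdSimplex ℝ (Fin M) :=
      convex_stdSimplex ℝ (Fin M) hθ hek (by linarith) ht.le (by ring)
    have h := hmin _ hη
    rw [sum_mul_bilin_single_sub B hB _ _ hθ.2, sum_mul_bilin_single_sub B hB _ _ hη.2] at h
    have hlin : ∀ g : Fin M → ℝ, ∑ j, ((1 - t) • θ + t • e) j * g j
        = (1 - t) * ∑ j, θ j * g j + t * g k := by
      intro g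
      rw [← hsum g, Finset.mul_sum, Finset.mul_sum, ← Finset.sum_add_distrib]
      refine Finset.sum_congr rfl fun j _ => ?_
      simp only [Pi.add_apply, Pi.smul_apply, smul_eq_mul]
      ring
    rw [hlin r, hlin fun j => B (Pi.single j 1) (Pi.single j 1)] at h
    simp only [map_add, map_smul, LinearMap.add_apply, LinearMap.smul_apply, smul_eq_mul,
      hB e θ, ← he] at h
    have h' : 0 ≤ t * (A - (1 / 2 * D - t / 2 * D)) := by
      rw [hA, hD]
      linear_combination h
    have := nonneg_of_mul_nonneg_right h' ht
    linarith
  have hfin : 1 / 2 * D ≤ A := by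
    by_contra! hlt
    have hD0 : 0 < |D| + 1 := by positivity
    set g := 1 / 2 * D - A
    have hg : 0 < g := by simp only [g]; linarith
    have h1 := key (min 1 (g / (|D| + 1))) (by positivity) (min_le_left _ _)
    have h2 : min 1 (g / (|D| + 1)) * (|D| + 1) ≤ g :=
      (mul_le_mul_of_nonneg_right (min_le_right _ _) hD0.le).trans_eq (by field_simp)
    have h3 : 0 < min 1 (g / (|D| + 1)) := by positivity
    have h4 := mul_le_mul_of_nonneg_left (le_abs_self D) h3.le
    simp only [g] at h2
    nlinarith
  rw [hA] at hfin
  linarith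

lemma integrable_mul_mul_weight {𝒳 : Type*} [MeasurableSpace 𝒳] {μ : Measure 𝒳}
    {g h w : 𝒳 → ℝ} (hg : Measurable g) (hh : Measurable h) (hw : Measurable w)
    (hw0 : ∀ t, 0 ≤ w t) (hgi : Integrable (fun t => g t ^ 2 * w t) μ)
    (hhi : Integrable (fun t => h t ^ 2 * w t) μ) :
    Integrable (fun t => g t * h t * w t) μ := by
  refine (hgi.add hhi).mono' ((hg.mul hh).mul hw).aestronglyMeasurable (ae_of_all _ fun t => ?_)
  rw [Real.norm_eq_abs, abs_mul, abs_of_nonneg (hw0 t), Pi.add_apply, ← add_mul]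
  refine mul_le_mul_of_nonneg_right ?_ (hw0 t)
  rw [abs_le]
  constructor <;> nlinarith [sq_nonneg (g t + h t), sq_nonneg (g t - h t), sq_nonneg (g t),
    sq_nonneg (h t)]

/-- The Gram form `⟪f_a, f_b⟫_w` of the dictionary, in coefficients. -/
noncomputable def gramForm {𝒳 : Type*} [MeasurableSpace 𝒳] (μ : Measure 𝒳) {M : ℕ}
    (w : 𝒳 → ℝ) (fs : Fin M → 𝒳 → ℝ) : LinearMap.BilinForm ℝ (Fin M → ℝ) :=
  Matrix.toBilin' (Matrix.of fun j k => ∫ t, fs j t * fs k t * w t ∂μ)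

lemma gramForm_apply {𝒳 : Type*} [MeasurableSpace 𝒳] (μ : Measure 𝒳) {M : ℕ}
    (w : 𝒳 → ℝ) (fs : Fin M → 𝒳 → ℝ) (a b : Fin M → ℝ) :
    gramForm μ w fs a b = ∑ j, ∑ k, a j * (∫ t, fs j t * fs k t * w t ∂μ) * b k := by
  simp [gramForm, Matrix.toBilin'_apply]

lemma gramForm_comm {𝒳 : Type*} [MeasurableSpace 𝒳] (μ : Measure 𝒳) {M : ℕ}
    (w : 𝒳 → ℝ) (fs : Fin M → 𝒳 → ℝ) (a b : Fin M → ℝ) :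
    gramForm μ w fs a b = gramForm μ w fs b a := by
  rw [gramForm_apply, gramForm_apply, Finset.sum_comm]
  refine Finset.sum_congr rfl fun j _ => Finset.sum_congr rfl fun k _ => ?_
  simp_rw [mul_comm (fs k _) (fs j _)]
  ring

lemma combo_single {𝒳 : Type*} {M : ℕ} (fs : Fin M → 𝒳 → ℝ) (j : Fin M) :
    combo fs (Pi.single j 1) = fs j := by
  ext t
  simp [combo, Pi.single_apply]

lemma combo_sub {𝒳 : Type*} {M : ℕ} (fs : Fin M → 𝒳 → ℝ) (a b : Fin M → ℝ) (t : 𝒳) :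
    combo fs (a - b) t = combo fs a t - combo fs b t := by
  simp [combo, sub_mul]

lemma integrable_and_integral_combo_sq {𝒳 : Type*} [MeasurableSpace 𝒳] {μ : Measure 𝒳} {M : ℕ}
    {w : 𝒳 → ℝ} {fs : Fin M → 𝒳 → ℝ}
    (hi : ∀ j k, Integrable (fun t => fs j t * fs k t * w t) μ) (a : Fin M → ℝ) :
    Integrable (fun t => combo fs a t ^ 2 * w t) μ ∧
      ∫ t, combo fs a t ^ 2 * w t ∂μ = gramForm μ w fs a a := by
  have h : (fun t => combo fs a t ^ 2 * w t)
      = fun t => ∑ j, ∑ k, a j * (fs j t * fs k t * w t) * a k := by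
    ext t
    rw [combo, sq, Finset.sum_mul_sum, Finset.sum_mul]
    refine Finset.sum_congr rfl fun j _ => ?_
    rw [Finset.sum_mul]
    refine Finset.sum_congr rfl fun k _ => ?_
    ring
  have hi' : ∀ j k, Integrable (fun t => a j * (fs j t * fs k t * w t) * a k) μ :=
    fun j k => ((hi j k).const_mul _).mul_const _
  refine ⟨?_, ?_⟩
  · rw [h]
    exact integrable_finsetSum _ fun j _ => integrable_finsetSum _ fun k _ => hi' j k
  · rw [h, gramForm_apply,
      integral_finsetSum _ fun j _ => integrable_finsetSum _ fun k _ => hi' j k]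
    refine Finset.sum_congr rfl fun j _ => ?_
    rw [integral_finsetSum _ fun k _ => hi' j k]
    refine Finset.sum_congr rfl fun k _ => ?_
    rw [integral_mul_const, integral_const_mul]

lemma integral_combo_sub_sq {𝒳 : Type*} [MeasurableSpace 𝒳] {μ : Measure 𝒳} {M : ℕ}
    {w f : 𝒳 → ℝ} {fs : Fin M → 𝒳 → ℝ}
    (hi : ∀ j k, Integrable (fun t => fs j t * fs k t * w t) μ)
    (hif : ∀ j, Integrable (fun t => fs j t * f t * w t) μ)
    (hf : Integrable (fun t => f t ^ 2 * w t) μ) (a : Fin M → ℝ) :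
    ∫ t, (combo fs a t - f t) ^ 2 * w t ∂μ
      = gramForm μ w fs a a - 2 * ∑ j, a j * ∫ t, fs j t * f t * w t ∂μ
        + ∫ t, f t ^ 2 * w t ∂μ := by
  obtain ⟨h1, h2⟩ := integrable_and_integral_combo_sq hi a
  have hi' : ∀ j, Integrable (fun t => a j * (fs j t * f t * w t)) μ :=
    fun j => (hif j).const_mul _
  have h3 : Integrable (fun t => ∑ j, a j * (fs j t * f t * w t)) μ :=
    integrable_finsetSum _ fun j _ => hi' j
  have h : (fun t => (combo fs a t - f t) ^ 2 * w t) = fun t => combo fs a t ^ 2 * w t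
      - 2 * (∑ j, a j * (fs j t * f t * w t)) + f t ^ 2 * w t := by
    ext t
    have : ∑ j, a j * (fs j t * f t * w t) = combo fs a t * f t * w t := by
      rw [combo, Finset.sum_mul, Finset.sum_mul]
      exact Finset.sum_congr rfl fun j _ => by ring
    rw [this]
    ring
  have h4 : Integrable (fun t => combo fs a t ^ 2 * w t
      - 2 * (∑ j, a j * (fs j t * f t * w t))) μ := h1.sub (h3.const_mul 2)
  rw [h, integral_add h4 hf, integral_sub h1 (h3.const_mul 2), h2,
    integral_const_mul, integral_finsetSum _ fun j _ => hi' j]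
  simp_rw [integral_const_mul]

lemma Vw_eq {𝒳 : Type*} [MeasurableSpace 𝒳] {μ : Measure 𝒳} {M n : ℕ}
    {w : 𝒳 → ℝ} {fs : Fin M → 𝒳 → ℝ}
    (hi : ∀ j k, Integrable (fun t => fs j t * fs k t * w t) μ)
    (ω : Fin n → 𝒳) (θ : Fin M → ℝ) :
    Vw μ w fs ω θ = gramForm μ w fs θ θ
      - ∑ j, θ j * (2 / (n : ℝ) * ∑ i, fs j (ω i) * w (ω i))
      + 1 / 2 * ∑ j, θ j * gramForm μ w fs (Pi.single j 1 - θ) (Pi.single j 1 - θ) := by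
  have h : 2 / (n : ℝ) * ∑ i, combo fs θ (ω i) * w (ω i)
      = ∑ j, θ j * (2 / (n : ℝ) * ∑ i, fs j (ω i) * w (ω i)) := by
    simp_rw [combo, Finset.sum_mul, Finset.mul_sum]
    rw [Finset.sum_comm]
    exact Finset.sum_congr rfl fun j _ => Finset.sum_congr rfl fun i _ => by ring
  simp_rw [Vw, h, ← (integrable_and_integral_combo_sq hi _).2, combo_sub, combo_single]

/-- Deterministic oracle inequality on the event where all the penalized empirical deviations
from the vertex `k` are at most `τ`. -/
lemma penalized_oracle_inequality {𝒳 : Type*} [MeasurableSpace 𝒳] {μ : Measure 𝒳} {M n : ℕ}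
    {w f : 𝒳 → ℝ} {fs : Fin M → 𝒳 → ℝ}
    (hi : ∀ j k, Integrable (fun t => fs j t * fs k t * w t) μ)
    (hif : ∀ j, Integrable (fun t => fs j t * f t * w t) μ)
    (hf : Integrable (fun t => f t ^ 2 * w t) μ)
    {ω : Fin n → 𝒳} {θ : Fin M → ℝ} (hθ : θ ∈ stdSimplex ℝ (Fin M))
    (hmin : ∀ η ∈ stdSimplex ℝ (Fin M), Vw μ w fs ω θ ≤ Vw μ w fs ω η) (k : Fin M) {τ : ℝ}
    (hdev : ∀ j, 2 / (n : ℝ) * ∑ i, (fs j (ω i) - fs k (ω i)) * w (ω i)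
      - 2 * ((∫ t, fs j t * f t * w t ∂μ) - ∫ t, fs k t * f t * w t ∂μ)
      - 1 / 2 * ∫ t, (fs j t - fs k t) ^ 2 * w t ∂μ ≤ τ) :
    ∫ t, (combo fs θ t - f t) ^ 2 * w t ∂μ ≤ (∫ t, (fs k t - f t) ^ 2 * w t ∂μ) + τ := by
  simp_rw [Vw_eq hi] at hmin
  have h1 := penalized_minimizer_le_vertex _ (gramForm_comm μ w fs) _ θ hθ hmin k
  have h2 := integral_combo_sub_sq hi hif hf (Pi.single k 1)
  rw [combo_single] at h2
  rw [integral_combo_sub_sq hi hif hf θ, h2]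
  simp_rw [← (integrable_and_integral_combo_sq hi (Pi.single _ 1 - Pi.single k 1)).2, combo_sub,
    combo_single] at h1
  have h3 : ∑ j, θ j * (2 / (n : ℝ) * ∑ i, (fs j (ω i) - fs k (ω i)) * w (ω i)
      - 2 * ((∫ t, fs j t * f t * w t ∂μ) - ∫ t, fs k t * f t * w t ∂μ)
      - 1 / 2 * ∫ t, (fs j t - fs k t) ^ 2 * w t ∂μ) ≤ τ := by
    calc _ ≤ ∑ j, θ j * τ :=
          Finset.sum_le_sum fun j _ => mul_le_mul_of_nonneg_left (hdev j) (hθ.1 j)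
      _ = τ := by rw [← Finset.sum_mul, hθ.2, one_mul]
  have h4 : ∑ j, θ j * (2 / (n : ℝ) * ∑ i, (fs j (ω i) - fs k (ω i)) * w (ω i)
      - 2 * ((∫ t, fs j t * f t * w t ∂μ) - ∫ t, fs k t * f t * w t ∂μ)
      - 1 / 2 * ∫ t, (fs j t - fs k t) ^ 2 * w t ∂μ)
      = ∑ j, θ j * (2 / (n : ℝ) * ∑ i, fs j (ω i) * w (ω i))
        - 2 / (n : ℝ) * ∑ i, fs k (ω i) * w (ω i)
        - 2 * ∑ j, θ j * (∫ t, fs j t * f t * w t ∂μ) + 2 * (∫ t, fs k t * f t * w t ∂μ)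
        - 1 / 2 * ∑ j, θ j * ∫ t, (fs j t - fs k t) ^ 2 * w t ∂μ := by
    have h5 : ∀ u b d : Fin M → ℝ, ∑ j, θ j * (u j - u k - 2 * (b j - b k) - 1 / 2 * d j)
        = ∑ j, θ j * u j - u k - 2 * ∑ j, θ j * b j + 2 * b k - 1 / 2 * ∑ j, θ j * d j := by
      intro u b d
      have h7 : ∀ j, θ j * (u j - u k - 2 * (b j - b k) - 1 / 2 * d j)
          = θ j * u j - θ j * u k - 2 * (θ j * b j) + θ j * (2 * b k) - 1 / 2 * (θ j * d j) :=
        fun j => by ring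
      simp_rw [h7, Finset.sum_sub_distrib, Finset.sum_add_distrib, Finset.sum_sub_distrib,
        ← Finset.mul_sum, ← Finset.sum_mul, hθ.2, one_mul]
    rw [← h5]
    refine Finset.sum_congr rfl fun j _ => ?_
    simp_rw [sub_mul, Finset.sum_sub_distrib, mul_sub]
  have h6 : ∑ j, (Pi.single k 1 : Fin M → ℝ) j * ∫ t, fs j t * f t * w t ∂μ
      = ∫ t, fs k t * f t * w t ∂μ := by
    simp [Pi.single_apply]
  rw [h6]
  linarith

/-- Exponential deviation bound for one penalized empirical difference. -/
lemma iidLaw_penalized_deviation_le {𝒳 : Type*} [MeasurableSpace 𝒳] {μ : Measure 𝒳} {n : ℕ}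
    (hn : 1 ≤ n) {L L0 : ℝ} (hL : 0 < L) (hL0 : 0 < L0) {w f g h : 𝒳 → ℝ}
    (hw : Measurable w) (hw0 : ∀ t, 0 ≤ w t) (hg : Measurable g) (hh : Measurable h)
    (hgb : ∀ᵐ t ∂μ, |w t * g t| ≤ L0) (hhb : ∀ᵐ t ∂μ, |w t * h t| ≤ L0)
    (hf : Measurable f) (hf0 : ∀ᵐ t ∂μ, 0 ≤ f t) (hfb : ∀ᵐ t ∂μ, |w t * f t| ≤ L)
    [IsProbabilityMeasure (μ.withDensity fun t => ENNReal.ofReal (f t))]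
    (hgf : Integrable (fun t => g t * f t * w t) μ)
    (hhf : Integrable (fun t => h t * f t * w t) μ)
    (hgh : Integrable (fun t => (g t - h t) ^ 2 * w t) μ) (τ : ℝ) :
    iidLaw μ n f {ω | τ ≤ 2 / (n : ℝ) * ∑ i, (g (ω i) - h (ω i)) * w (ω i)
      - 2 * ((∫ t, g t * f t * w t ∂μ) - ∫ t, h t * f t * w t ∂μ)
      - 1 / 2 * ∫ t, (g t - h t) ^ 2 * w t ∂μ}
      ≤ ENNReal.ofReal (exp (-(n * τ / (8 * (L + L0))))) := by
  set ν := μ.withDensity fun t => ENNReal.ofReal (f t) with hν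
  set D := ∫ t, (g t - h t) ^ 2 * w t ∂μ with hD
  have hD0 : 0 ≤ D := integral_nonneg fun t => mul_nonneg (sq_nonneg _) (hw0 t)
  have hν_int : ∀ u : 𝒳 → ℝ, ∫ t, u t ∂ν = ∫ t, f t * u t ∂μ := by
    intro u
    rw [hν, integral_withDensity_eq_integral_toReal_smul hf.ennreal_ofReal
      (ae_of_all _ fun _ => ENNReal.ofReal_lt_top)]
    refine integral_congr_ae ?_
    filter_upwards [hf0] with t ht
    rw [ENNReal.toReal_ofReal ht, smul_eq_mul]
  set Y : 𝒳 → ℝ := fun t => (g t - h t) * w t with hYdef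
  have hY : Measurable Y := (hg.sub hh).mul hw
  have hYb : ∀ᵐ t ∂ν, |Y t| ≤ 2 * L0 := by
    refine (withDensity_absolutelyContinuous μ _).ae_le ?_
    filter_upwards [hgb, hhb] with t h1 h2
    have : Y t = w t * g t - w t * h t := by simp only [hYdef]; ring
    rw [this]
    exact (abs_sub _ _).trans (by linarith)
  have hmean : ∫ t, Y t ∂ν = (∫ t, g t * f t * w t ∂μ) - ∫ t, h t * f t * w t ∂μ := by
    rw [hν_int, ← integral_sub hgf hhf]
    refine integral_congr_ae (ae_of_all _ fun t => ?_)
    simp only [hYdef]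
    ring
  have hvar : ∫ t, Y t ^ 2 ∂ν ≤ L * D := by
    rw [hν_int, hD, ← integral_const_mul]
    refine integral_mono_of_nonneg ?_ (hgh.const_mul L) ?_
    · filter_upwards [hf0] with t ht using mul_nonneg ht (sq_nonneg _)
    · filter_upwards [hfb] with t ht
      have : f t * Y t ^ 2 = (w t * f t) * ((g t - h t) ^ 2 * w t) := by
        simp only [hYdef]; ring
      rw [this]
      exact mul_le_mul_of_nonneg_right ((le_abs_self _).trans ht)
        (mul_nonneg (sq_nonneg _) (hw0 t))
  have hn0 : (0 : ℝ) < n := by exact_mod_cast hn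
  set l : ℝ := 1 / (4 * (L + L0)) with hl
  have hl0 : 0 < l := by positivity
  have hlL : l * (4 * (L + L0)) = 1 := by rw [hl]; field_simp
  have hchern := measure_pi_le_mul_sum_le hY hYb hl0.le (by nlinarith) hvar n
    (l * n / 2 * (τ + 2 * (∫ t, Y t ∂ν) + 1 / 2 * D))
  rw [hmean] at hchern
  refine (measure_mono fun ω hω => ?_).trans (hchern.trans (ENNReal.ofReal_le_ofReal
    (exp_le_exp.2 ?_)))
  · simp only [Set.mem_ofPred_eq] at hω ⊢
    have h1 : l * ∑ i, Y (ω i) = l * n / 2 * (2 / n * ∑ i, Y (ω i)) := by field_simp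
    rw [h1]
    exact mul_le_mul_of_nonneg_left (by simp only [hYdef]; linarith) (by positivity)
  · have h1 : n * τ / (8 * (L + L0)) = l * n / 2 * τ := by rw [hl]; field_simp; ring
    have h2 : l * L ≤ 1 / 4 := by nlinarith
    have h3 : 0 ≤ n * l * D * (1 / 4 - l * L) :=
      mul_nonneg (by positivity) (by linarith)
    rw [h1]
    linear_combination h3

/-- sharp oracle inequality for the weighted-loss penalized procedure
(Section 3.3). -/
theorem weighted_penalized_erm_oracle_inequality :
    ∃ c : ℝ, 0 < c ∧
      ∀ (𝒳 : Type*) (_ : MeasurableSpace 𝒳) (μ : Measure 𝒳)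
        (M n : ℕ), 1 ≤ M → 1 ≤ n →
      ∀ (L L0 : ℝ), 0 < L → 0 < L0 →
      ∀ w : 𝒳 → ℝ, Measurable w → (∀ t, 0 ≤ w t) →
      ∀ fs : Fin M → 𝒳 → ℝ, (∀ j, Measurable (fs j)) →
        (∀ j, Integrable (fun t => fs j t ^ 2 * w t) μ) →
        (∀ j, ∀ᵐ t ∂μ, |w t * fs j t| ≤ L0) →
      ∀ f : 𝒳 → ℝ, Measurable f → (∀ᵐ t ∂μ, 0 ≤ f t) → (∫ t, f t ∂μ) = 1 →
        Integrable (fun t => f t ^ 2 * w t) μ → (∀ᵐ t ∂μ, |w t * f t| ≤ L) →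
      ∀ θhat : (Fin n → 𝒳) → Fin M → ℝ,
        (∀ ω, θhat ω ∈ stdSimplex ℝ (Fin M)) →
        (∀ ω, ∀ θ ∈ stdSimplex ℝ (Fin M), Vw μ w fs ω (θhat ω) ≤ Vw μ w fs ω θ) →
      ∀ x : ℝ, 0 < x →
        iidLaw μ n f
          {ω | (∫ t, (combo fs (θhat ω) t - f t) ^ 2 * w t ∂μ)
            ≤ (⨅ j, ∫ t, (fs j t - f t) ^ 2 * w t ∂μ)
              + c * (L + L0) * (x + Real.log M) / (n : ℝ)}
          > ENNReal.ofReal (1 - Real.exp (-x)) := by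
  refine ⟨16, by norm_num, ?_⟩
  intro 𝒳 _ μ M n hM hn L L0 hL hL0 w hw hw0 fs hfs hfsi hfsb f hf hf0 hf1 hfi hfb θhat hθ hmin
    x hx
  have hi : ∀ j k, Integrable (fun t => fs j t * fs k t * w t) μ := fun j k =>
    integrable_mul_mul_weight (hfs j) (hfs k) hw hw0 (hfsi j) (hfsi k)
  have hif : ∀ j, Integrable (fun t => fs j t * f t * w t) μ := fun j =>
    integrable_mul_mul_weight (hfs j) hf hw hw0 (hfsi j) hfi
  have hd : ∀ j k, Integrable (fun t => (fs j t - fs k t) ^ 2 * w t) μ := fun j k => by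
    have h := (integrable_and_integral_combo_sq hi (Pi.single j 1 - Pi.single k 1)).1
    simp only [combo_sub, combo_single] at h
    exact h
  have hprob : IsProbabilityMeasure (μ.withDensity fun t => ENNReal.ofReal (f t)) := by
    constructor
    have hf_int : Integrable f μ := Integrable.of_integral_ne_zero (by rw [hf1]; norm_num)
    rw [withDensity_apply _ MeasurableSet.univ, Measure.restrict_univ,
      ← ofReal_integral_eq_lintegral_ofReal hf_int hf0, hf1, ENNReal.ofReal_one]
  have : IsProbabilityMeasure (iidLaw μ n f) := by unfold iidLaw; infer_instance
  have : Nonempty (Fin M) := ⟨⟨0, hM⟩⟩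
  obtain ⟨k, hk⟩ := exists_eq_ciInf_of_finite
    (f := fun j => ∫ t, (fs j t - f t) ^ 2 * w t ∂μ)
  rw [← hk]
  have hn0 : (0 : ℝ) < n := by exact_mod_cast hn
  have hM0 : (1 : ℝ) ≤ M := by exact_mod_cast hM
  set τ : ℝ := 16 * (L + L0) * (x + Real.log M) / n with hτ
  set bad : Fin M → Set (Fin n → 𝒳) := fun j =>
    {ω | τ ≤ 2 / (n : ℝ) * ∑ i, (fs j (ω i) - fs k (ω i)) * w (ω i)
      - 2 * ((∫ t, fs j t * f t * w t ∂μ) - ∫ t, fs k t * f t * w t ∂μ)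
      - 1 / 2 * ∫ t, (fs j t - fs k t) ^ 2 * w t ∂μ} with hbad
  have hbadm : ∀ j, MeasurableSet (bad j) := fun j =>
    measurableSet_le measurable_const (by have := hfs; fun_prop)
  have hbadp : ∀ j, iidLaw μ n f (bad j) ≤ ENNReal.ofReal (exp (-(2 * (x + Real.log M)))) := by
    intro j
    have h := iidLaw_penalized_deviation_le hn hL hL0 hw hw0 (hfs j) (hfs k) (hfsb j) (hfsb k)
      hf hf0 hfb (hif j) (hif k) (hd j k) τ
    have h1 : n * τ / (8 * (L + L0)) = 2 * (x + Real.log M) := by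
      have : L + L0 ≠ 0 := by positivity
      rw [hτ]
      field_simp
      norm_num
    rwa [h1] at h
  have hunion : iidLaw μ n f (⋃ j, bad j) ≤ ENNReal.ofReal (exp (-(2 * x))) := by
    calc iidLaw μ n f (⋃ j, bad j) ≤ ∑ j, iidLaw μ n f (bad j) := measure_iUnion_fintype_le _ _
      _ ≤ ∑ _j : Fin M, ENNReal.ofReal (exp (-(2 * (x + Real.log M)))) :=
          Finset.sum_le_sum fun j _ => hbadp j
      _ = ENNReal.ofReal (M * exp (-(2 * (x + Real.log M)))) := by
          rw [Finset.sum_const, Finset.card_univ, Fintype.card_fin, nsmul_eq_mul,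
            ENNReal.ofReal_mul (Nat.cast_nonneg M), ENNReal.ofReal_natCast]
      _ ≤ _ := by
          refine ENNReal.ofReal_le_ofReal ?_
          conv_lhs => rw [← exp_log (zero_lt_one.trans_le hM0), ← exp_add, log_exp]
          exact exp_le_exp.2 (by linarith [log_nonneg hM0])
  refine lt_of_lt_of_le ?_ (measure_mono (s := (⋃ j, bad j)ᶜ) fun ω hω => ?_)
  · rw [prob_compl_eq_one_sub (MeasurableSet.iUnion hbadm)]
    refine lt_of_lt_of_le ?_ (tsub_le_tsub_left hunion 1)
    rw [← ENNReal.ofReal_one, ← ENNReal.ofReal_sub _ (exp_pos _).le,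
      ENNReal.ofReal_lt_ofReal_iff (by simpa using hx)]
    exact sub_lt_sub_left (exp_lt_exp.2 (by linarith)) 1
  · refine penalized_oracle_inequality hi hif hfi (hθ ω) (hmin ω) k fun j => ?_
    simp only [hbad, Set.mem_compl_iff, Set.mem_iUnion, not_exists, Set.mem_ofPred_eq,
      not_le] at hω
    exact (hω j).le
end

section
/- There exists an absolute constant c > 0 such that the following holds. Let (X,Y) be a random couple valued in 𝒳 × ℝ with design distribution P_X and regression function f(x) = E[Y | X = x], and let (X_1,Y_1),…,(X_n,Y_n) be n i.i.d. copies of (X,Y). Let f_1,…,f_M ∈ L²(P_X) and assume that for some b > 0, |Y| ≤ b and max_{j=1,…,M} |f_j(X)| ≤ b almost surely. Let θ̂ ∈ argmin_{θ∈Λ^M} V_n(θ) where V_n(θ) = ‖f_θ‖²_{P_X} − (2/n)Σ_{i=1}^n f_θ(X_i)·Y_i + (1/2)·Σ_{j=1}^M θ_j·‖f_j − f_θ‖²_{P_X}. Then for any x > 0, with probability greater than 1 − exp(−x), ‖f_θ̂ − f‖²_{P_X} ≤ min_{j=1,…,M} ‖f_j − f‖²_{P_X} + c·b²·(x + log M)/n.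 -/
open MeasureTheory Real

/-- The penalized empirical objective for regression with known design:
`V_n(θ) = ‖f_θ‖²_{P_X} − (2/n)∑ᵢ f_θ(Xᵢ)Yᵢ + (1/2)∑ⱼ θⱼ ‖fⱼ − f_θ‖²_{P_X}`. -/
noncomputable def Vreg {𝒳 : Type*} [MeasurableSpace 𝒳] (PX : Measure 𝒳) {M n : ℕ}
    (fs : Fin M → 𝒳 → ℝ) (ω : Fin n → 𝒳 × ℝ) (θ : Fin M → ℝ) : ℝ :=
  (∫ u, combo fs θ u ^ 2 ∂PX)
    - (2 / (n : ℝ)) * ∑ i, combo fs θ (ω i).1 * (ω i).2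
    + (1 / 2) * ∑ j, θ j * ∫ u, (fs j u - combo fs θ u) ^ 2 ∂PX

section CondExp

variable {𝒳 : Type*} [MeasurableSpace 𝒳] {ν : Measure (𝒳 × ℝ)} [IsProbabilityMeasure ν]
  {b : ℝ} {f : 𝒳 → ℝ}

/-- A version of the regression function inherits the almost sure bound on the response. -/
lemma regressionFunction_abs_le (hb : 0 ≤ b) (hf : Measurable f)
    (hfY : ∀ A : Set 𝒳, MeasurableSet A →
      (∫ p in Prod.fst ⁻¹' A, p.2 ∂ν) = ∫ p in Prod.fst ⁻¹' A, f p.1 ∂ν)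
    (hY : ∀ᵐ p ∂ν, |p.2| ≤ b) : ∀ᵐ p ∂ν, |f p.1| ≤ b := by
  have hm : MeasurableSpace.comap Prod.fst inferInstance ≤
      (inferInstance : MeasurableSpace (𝒳 × ℝ)) := measurable_fst.comap_le
  have key (k : ℕ) : ∀ᵐ p ∂ν, |f p.1| ≤ k → |f p.1| ≤ b := by
    set S : Set 𝒳 := {u | |f u| ≤ k} with hS
    have hSm : MeasurableSet S := measurableSet_le hf.abs measurable_const
    have hSp : MeasurableSet (Prod.fst ⁻¹' S : Set (𝒳 × ℝ)) := measurable_fst hSm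
    have hYb : ∀ᵐ p ∂ν, |(Prod.fst ⁻¹' S).indicator Prod.snd p| ≤ b := by
      filter_upwards [hY] with p hp
      by_cases h : p ∈ (Prod.fst ⁻¹' S : Set (𝒳 × ℝ)) <;> simp [h, hp, hb]
    have hYi : Integrable ((Prod.fst ⁻¹' S).indicator (Prod.snd : 𝒳 × ℝ → ℝ)) ν :=
      Integrable.of_bound (measurable_snd.indicator hSp).aestronglyMeasurable b hYb
    have hfi : Integrable (fun p : 𝒳 × ℝ => S.indicator f p.1) ν := by
      refine Integrable.of_bound
        ((hf.indicator hSm).comp measurable_fst).aestronglyMeasurable k (.of_forall fun p => ?_)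
      by_cases h : p.1 ∈ S
      · rw [Set.indicator_of_mem h]
        exact h
      · simp [h]
    have hce : (fun p : 𝒳 × ℝ => S.indicator f p.1) =ᵐ[ν]
        ν[(Prod.fst ⁻¹' S).indicator Prod.snd | MeasurableSpace.comap Prod.fst inferInstance] := by
      refine ae_eq_condExp_of_forall_setIntegral_eq hm hYi (fun _ _ _ => hfi.integrableOn) ?_ ?_
      · rintro _ ⟨A, hA, rfl⟩ -
        have : (fun p : 𝒳 × ℝ => S.indicator f p.1) =
          (Prod.fst ⁻¹' S).indicator (fun p => f p.1) := rfl
        rw [this, setIntegral_indicator hSp, setIntegral_indicator hSp, ← Set.preimage_inter]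
        exact (hfY _ (hA.inter hSm)).symm
      · refine StronglyMeasurable.aestronglyMeasurable (Measurable.stronglyMeasurable ?_)
        exact (hf.indicator hSm).comp (comap_measurable _)
    have hbd : ∀ᵐ p ∂ν, |(ν[(Prod.fst ⁻¹' S).indicator Prod.snd |
        MeasurableSpace.comap Prod.fst inferInstance]) p| ≤ b :=
      ae_bdd_abs_condExp_of_ae_bdd_abs hYb
    filter_upwards [hce, hbd] with p h1 h2 h3
    rw [← h1, Set.indicator_of_mem (show p.1 ∈ S from h3)] at h2
    exact h2
  filter_upwards [ae_all_iff.2 key] with p hp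
  obtain ⟨k, hk⟩ := exists_nat_ge |f p.1|
  exact hp k hk

lemma integral_mul_snd_eq_integral_mul_regressionFunction (hb : 0 ≤ b) (hf : Measurable f)
    (hfY : ∀ A : Set 𝒳, MeasurableSet A →
      (∫ p in Prod.fst ⁻¹' A, p.2 ∂ν) = ∫ p in Prod.fst ⁻¹' A, f p.1 ∂ν)
    (hY : ∀ᵐ p ∂ν, |p.2| ≤ b) {h : 𝒳 → ℝ} (hh : Measurable h) {B : ℝ}
    (hB : ∀ᵐ p ∂ν, |h p.1| ≤ B) :
    ∫ p, h p.1 * p.2 ∂ν = ∫ u, h u * f u ∂(ν.map Prod.fst) := by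
  have hm : MeasurableSpace.comap Prod.fst inferInstance ≤
      (inferInstance : MeasurableSpace (𝒳 × ℝ)) := measurable_fst.comap_le
  have hYi : Integrable (Prod.snd : 𝒳 × ℝ → ℝ) ν :=
    Integrable.of_bound measurable_snd.aestronglyMeasurable b hY
  have hfi : Integrable (fun p : 𝒳 × ℝ => f p.1) ν :=
    Integrable.of_bound (hf.comp measurable_fst).aestronglyMeasurable b
      (regressionFunction_abs_le hb hf hfY hY)
  have hce : (fun p : 𝒳 × ℝ => f p.1) =ᵐ[ν]
      ν[Prod.snd | MeasurableSpace.comap Prod.fst inferInstance] := by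
    refine ae_eq_condExp_of_forall_setIntegral_eq hm hYi (fun _ _ _ => hfi.integrableOn) ?_ ?_
    · rintro _ ⟨A, hA, rfl⟩ -
      exact (hfY _ hA).symm
    · exact (Measurable.stronglyMeasurable
        (hf.comp (comap_measurable _))).aestronglyMeasurable
  have hhm : StronglyMeasurable[MeasurableSpace.comap Prod.fst inferInstance]
      (fun p : 𝒳 × ℝ => h p.1) :=
    Measurable.stronglyMeasurable (hh.comp (comap_measurable _))
  have hpi : Integrable ((fun p : 𝒳 × ℝ => h p.1) * Prod.snd) ν :=
    hYi.bdd_mul (hh.comp measurable_fst).aestronglyMeasurable hB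
  have hpull := condExp_mul_of_stronglyMeasurable_left hhm hpi hYi
  have hhf : Measurable fun u => h u * f u := hh.mul hf
  rw [integral_map measurable_fst.aemeasurable hhf.aestronglyMeasurable]
  calc ∫ p, h p.1 * p.2 ∂ν
      = ∫ p, (ν[(fun p : 𝒳 × ℝ => h p.1) * Prod.snd |
          MeasurableSpace.comap Prod.fst inferInstance]) p ∂ν := (integral_condExp hm).symm
    _ = ∫ p, h p.1 * f p.1 ∂ν := by
      refine integral_congr_ae ?_
      filter_upwards [hpull, hce] with p h1 h2
      rw [h1, Pi.mul_apply, h2]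

end CondExp

section Deviation

variable {α : Type*} [MeasurableSpace α] {ν : Measure α} [IsProbabilityMeasure ν]

lemma integral_exp_le_one_of_bounded {Z : α → ℝ} (hZ : Measurable Z) {b v : ℝ} (hb : 0 < b)
    (hbd : ∀ᵐ a ∂ν, |Z a| ≤ 2 * b ^ 2) (hv : ∫ a, Z a ^ 2 ∂ν ≤ b ^ 2 * v) :
    Integrable (fun a => exp ((Z a - ∫ a, Z a ∂ν - v / 4) / (4 * b ^ 2))) ν ∧
      ∫ a, exp ((Z a - ∫ a, Z a ∂ν - v / 4) / (4 * b ^ 2)) ∂ν ≤ 1 := by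
  have hb2 : 0 < 4 * b ^ 2 := by positivity
  have hZi : Integrable Z ν := Integrable.of_bound hZ.aestronglyMeasurable _ hbd
  set m := ∫ a, Z a ∂ν with hm
  have hmb : |m| ≤ 2 * b ^ 2 := by
    simpa using norm_integral_le_of_norm_le_const (μ := ν) (f := Z) hbd
  have hW : ∀ᵐ a ∂ν, |(Z a - m) / (4 * b ^ 2)| ≤ 1 := by
    filter_upwards [hbd] with a ha
    rw [abs_div, abs_of_pos hb2, div_le_one hb2]
    have := abs_sub (Z a) m
    linarith
  have hWm : Measurable fun a => (Z a - m) / (4 * b ^ 2) := (hZ.sub_const m).div_const _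
  have hWe : Integrable (fun a => exp ((Z a - m) / (4 * b ^ 2))) ν := by
    refine Integrable.of_bound hWm.exp.aestronglyMeasurable (exp 1) ?_
    filter_upwards [hW] with a ha
    rw [norm_of_nonneg (exp_pos _).le]
    exact exp_le_exp.2 (le_of_abs_le ha)
  have hZ2 : Integrable (fun a => Z a ^ 2) ν := by
    refine Integrable.of_bound (hZ.pow_const 2).aestronglyMeasurable ((2 * b ^ 2) ^ 2) ?_
    filter_upwards [hbd] with a ha
    rw [norm_pow]
    exact pow_le_pow_left₀ (norm_nonneg _) ha 2
  have hsplit : (fun a => exp ((Z a - m - v / 4) / (4 * b ^ 2))) =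
      fun a => exp ((Z a - m) / (4 * b ^ 2)) * exp (-(v / 4 / (4 * b ^ 2))) := by
    ext a
    rw [← exp_add]
    congr 1
    ring
  rw [hsplit]
  refine ⟨hWe.mul_const _, ?_⟩
  rw [integral_mul_const, exp_neg, ← div_eq_mul_inv, div_le_one (exp_pos _)]
  have hq : Integrable (fun a => (1 + (Z a - m) / (4 * b ^ 2)) +
      (Z a ^ 2 - 2 * m * Z a + m ^ 2) / (4 * b ^ 2) ^ 2) ν := by fun_prop
  calc ∫ a, exp ((Z a - m) / (4 * b ^ 2)) ∂ν
      ≤ ∫ a, ((1 + (Z a - m) / (4 * b ^ 2)) +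
          (Z a ^ 2 - 2 * m * Z a + m ^ 2) / (4 * b ^ 2) ^ 2) ∂ν := by
        refine integral_mono_ae hWe hq ?_
        filter_upwards [hW] with a ha
        have h1 := le_of_abs_le (Real.abs_exp_sub_one_sub_id_le ha)
        have h2 : ((Z a - m) / (4 * b ^ 2)) ^ 2 =
          (Z a ^ 2 - 2 * m * Z a + m ^ 2) / (4 * b ^ 2) ^ 2 := by rw [div_pow]; ring
        linarith
    _ = 1 + (∫ a, Z a ^ 2 ∂ν - m ^ 2) / (4 * b ^ 2) ^ 2 := by
        rw [integral_add (by fun_prop) (by fun_prop), integral_add (by fun_prop) (by fun_prop),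
          integral_div, integral_div, integral_sub (by fun_prop) (by fun_prop),
          integral_add (by fun_prop) (by fun_prop), integral_sub (by fun_prop) (by fun_prop),
          integral_const_mul, ← hm]
        simp
        ring
    _ ≤ 1 + v / 4 / (4 * b ^ 2) := by
        have : v / 4 / (4 * b ^ 2) = b ^ 2 * v / (4 * b ^ 2) ^ 2 := by field_simp
        rw [this]
        gcongr
        nlinarith [sq_nonneg m]
    _ ≤ exp (v / 4 / (4 * b ^ 2)) := by linarith [add_one_le_exp (v / 4 / (4 * b ^ 2))]

lemma measureReal_pi_le_sum_le_exp_neg {U : α → ℝ} (hUi : Integrable (fun a => exp (U a)) ν)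
    (hU : ∫ a, exp (U a) ∂ν ≤ 1) (n : ℕ) (t : ℝ) :
    (Measure.pi fun _ : Fin n => ν).real {ω | t ≤ ∑ i, U (ω i)} ≤ exp (-t) := by
  have hprod : (fun ω : Fin n → α => exp (1 * ∑ i, U (ω i))) = fun ω => ∏ i, exp (U (ω i)) := by
    ext ω
    rw [one_mul, exp_sum]
  have hexp_int : Integrable (fun ω : Fin n → α => exp (1 * ∑ i, U (ω i)))
      (Measure.pi fun _ : Fin n => ν) := by
    rw [hprod]
    exact Integrable.fintype_prod (f := fun _ : Fin n => fun a => exp (U a)) fun _ => hUi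
  have hmgf : ProbabilityTheory.mgf (fun ω : Fin n → α => ∑ i, U (ω i))
      (Measure.pi fun _ : Fin n => ν) 1 ≤ 1 := by
    rw [ProbabilityTheory.mgf, hprod,
      integral_fintype_prod_eq_prod (fun _ : Fin n => fun a => exp (U a))]
    exact Finset.prod_le_one (fun _ _ => integral_nonneg fun _ => (exp_pos _).le) fun _ _ => hU
  calc _ ≤ exp (-1 * t) * ProbabilityTheory.mgf (fun ω : Fin n → α => ∑ i, U (ω i))
        (Measure.pi fun _ : Fin n => ν) 1 :=
        ProbabilityTheory.measure_ge_le_exp_mul_mgf t zero_le_one hexp_int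
    _ ≤ exp (-t) := by
        rw [neg_one_mul]
        exact mul_le_of_le_one_right (exp_pos _).le hmgf

end Deviation

section Quadratic

variable {𝒳 : Type*} [MeasurableSpace 𝒳] {P : Measure 𝒳} {M n : ℕ} {fs : Fin M → 𝒳 → ℝ}

lemma MeasureTheory.MemLp.integral_sub_sq {g h : 𝒳 → ℝ} (hg : MemLp g 2 P) (hh : MemLp h 2 P) :
    ∫ u, (g u - h u) ^ 2 ∂P = ∫ u, g u ^ 2 ∂P - 2 * ∫ u, g u * h u ∂P + ∫ u, h u ^ 2 ∂P := by
  have h1 := hg.integrable_sq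
  have h2 := hh.integrable_sq
  have h3 : Integrable (fun u => g u * h u) P := hg.integrable_mul hh
  have : (fun u => (g u - h u) ^ 2) = fun u => g u ^ 2 - 2 * (g u * h u) + h u ^ 2 := by
    ext u; ring
  rw [this, integral_add (by fun_prop) (by fun_prop), integral_sub (by fun_prop) (by fun_prop),
    integral_const_mul]

lemma memLp_combo (hfs : ∀ j, MemLp (fs j) 2 P) (θ : Fin M → ℝ) : MemLp (combo fs θ) 2 P :=
  memLp_finsetSum _ fun j _ => (hfs j).const_mul (θ j)

lemma integral_combo_mul (hfs : ∀ j, MemLp (fs j) 2 P) (θ : Fin M → ℝ) {h : 𝒳 → ℝ}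
    (hh : MemLp h 2 P) :
    ∫ u, combo fs θ u * h u ∂P = ∑ j, θ j * ∫ u, fs j u * h u ∂P := by
  simp only [combo, Finset.sum_mul, mul_assoc]
  have hi (j : Fin M) : Integrable (fun u => fs j u * h u) P := (hfs j).integrable_mul hh
  rw [integral_finsetSum _ fun j _ => (hi j).const_mul (θ j)]
  simp only [integral_const_mul]

lemma Vreg_eq_of_sum_eq_one (hfs : ∀ j, MemLp (fs j) 2 P) (ω : Fin n → 𝒳 × ℝ) {θ : Fin M → ℝ}
    (hθ : ∑ j, θ j = 1) :
    Vreg P fs ω θ = 1 / 2 * ∫ u, combo fs θ u ^ 2 ∂P +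
      ∑ j, θ j * (1 / 2 * ∫ u, fs j u ^ 2 ∂P - 2 / n * ∑ i, fs j (ω i).1 * (ω i).2) := by
  have hc := memLp_combo hfs θ
  have hpen : ∑ j, θ j * ∫ u, (fs j u - combo fs θ u) ^ 2 ∂P =
      ∑ j, θ j * ∫ u, fs j u ^ 2 ∂P - ∫ u, combo fs θ u ^ 2 ∂P := by
    have hcc : ∑ j, θ j * ∫ u, fs j u * combo fs θ u ∂P = ∫ u, combo fs θ u ^ 2 ∂P := by
      rw [← integral_combo_mul hfs θ hc]
      simp only [pow_two]
    simp only [(hfs _).integral_sub_sq hc, mul_add, mul_sub, Finset.sum_add_distrib,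
      Finset.sum_sub_distrib, ← Finset.sum_mul, hθ, one_mul]
    simp only [mul_left_comm _ (2 : ℝ), ← Finset.mul_sum, hcc]
    ring
  have hemp : ∑ i, combo fs θ (ω i).1 * (ω i).2 =
      ∑ j, θ j * ∑ i, fs j (ω i).1 * (ω i).2 := by
    simp only [combo, Finset.sum_mul, Finset.mul_sum, mul_assoc]
    exact Finset.sum_comm
  rw [Vreg, hpen, hemp]
  simp only [mul_sub, Finset.sum_sub_distrib, mul_left_comm _ (1 / 2 : ℝ),
    mul_left_comm _ (2 / n : ℝ), ← Finset.mul_sum]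
  ring

/-- The objective is a quadratic with Hessian `‖f_·‖²`, so its growth away from the minimizer is at
least quadratic. -/
lemma Vreg_add_le_of_isMinOn (hfs : ∀ j, MemLp (fs j) 2 P) (ω : Fin n → 𝒳 × ℝ) {θ η : Fin M → ℝ}
    (hθ : θ ∈ stdSimplex ℝ (Fin M)) (hη : η ∈ stdSimplex ℝ (Fin M))
    (hmin : IsMinOn (Vreg P fs ω) (stdSimplex ℝ (Fin M)) θ) :
    Vreg P fs ω θ + 1 / 2 * ∫ u, (combo fs η u - combo fs θ u) ^ 2 ∂P ≤ Vreg P fs ω η := by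
  have hcθ := memLp_combo hfs θ
  have hcη := memLp_combo hfs η
  set D := ∫ u, (combo fs η u - combo fs θ u) ^ 2 ∂P with hD
  have step (ε : ℝ) (h0 : 0 < ε) (h1 : ε ≤ 1) :
      Vreg P fs ω θ + 1 / 2 * ((1 - ε) * D) ≤ Vreg P fs ω η := by
    have hmem : (1 - ε) • θ + ε • η ∈ stdSimplex ℝ (Fin M) :=
      convex_stdSimplex ℝ (Fin M) hθ hη (by linarith) h0.le (by ring)
    have hle := isMinOn_iff.1 hmin _ hmem
    have hsq : ∫ u, combo fs ((1 - ε) • θ + ε • η) u ^ 2 ∂P =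
        (1 - ε) * ∫ u, combo fs θ u ^ 2 ∂P + ε * ∫ u, combo fs η u ^ 2 ∂P
          - ε * (1 - ε) * D := by
      have i1 := hcθ.integrable_sq
      have i2 := hcη.integrable_sq
      have i3 : Integrable (fun u => (combo fs η u - combo fs θ u) ^ 2) P :=
        (hcη.sub hcθ).integrable_sq
      have : (fun u => combo fs ((1 - ε) • θ + ε • η) u ^ 2) = fun u =>
          (1 - ε) * combo fs θ u ^ 2 + ε * combo fs η u ^ 2 -
            ε * (1 - ε) * (combo fs η u - combo fs θ u) ^ 2 := by
        ext u
        have : combo fs ((1 - ε) • θ + ε • η) u =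
            (1 - ε) * combo fs θ u + ε * combo fs η u := by
          simp only [combo, Pi.add_apply, Pi.smul_apply, smul_eq_mul, add_mul, mul_assoc,
            Finset.sum_add_distrib, Finset.mul_sum]
        rw [this]
        ring
      rw [this, integral_sub (by fun_prop) (by fun_prop), integral_add (by fun_prop) (by fun_prop),
        integral_const_mul, integral_const_mul, integral_const_mul]
    rw [Vreg_eq_of_sum_eq_one hfs ω hθ.2, Vreg_eq_of_sum_eq_one hfs ω hmem.2, hsq] at hle
    rw [Vreg_eq_of_sum_eq_one hfs ω hθ.2, Vreg_eq_of_sum_eq_one hfs ω hη.2]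
    simp only [Pi.add_apply, Pi.smul_apply, smul_eq_mul, add_mul, mul_assoc,
      Finset.sum_add_distrib, ← Finset.mul_sum] at hle
    refine le_of_mul_le_mul_left ?_ h0
    linarith
  have hlim : Filter.Tendsto (fun ε : ℝ => Vreg P fs ω θ + 1 / 2 * ((1 - ε) * D))
      (nhdsWithin 0 (Set.Ioi 0)) (nhds (Vreg P fs ω θ + 1 / 2 * ((1 - 0) * D))) :=
    (Continuous.tendsto (by fun_prop) 0).mono_left nhdsWithin_le_nhds
  rw [sub_zero, one_mul] at hlim
  refine le_of_tendsto hlim ?_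
  filter_upwards [Ioc_mem_nhdsGT (zero_lt_one' ℝ)] with ε hε using step ε hε.1 hε.2

/-- The excess risk of a minimizer of the objective over `fs k` is a convex combination of penalized
centered empirical processes. -/
lemma integral_combo_sub_sq_le_of_isMinOn (hfs : ∀ j, MemLp (fs j) 2 P) {f : 𝒳 → ℝ}
    (hf : MemLp f 2 P) (ω : Fin n → 𝒳 × ℝ) {θ : Fin M → ℝ} (hθ : θ ∈ stdSimplex ℝ (Fin M))
    (hmin : IsMinOn (Vreg P fs ω) (stdSimplex ℝ (Fin M)) θ) (k : Fin M) :
    ∫ u, (combo fs θ u - f u) ^ 2 ∂P ≤ ∫ u, (fs k u - f u) ^ 2 ∂P +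
      ∑ j, θ j * (2 / n * ∑ i, (fs j (ω i).1 - fs k (ω i).1) * (ω i).2
        - 2 * ∫ u, (fs j u - fs k u) * f u ∂P - 1 / 2 * ∫ u, (fs j u - fs k u) ^ 2 ∂P) := by
  have hk : Pi.single k 1 ∈ stdSimplex ℝ (Fin M) := single_mem_stdSimplex ℝ k
  have hck : combo fs (Pi.single k 1) = fs k := by
    ext u
    simp [combo, Pi.single_apply]
  have hle := Vreg_add_le_of_isMinOn hfs ω hθ hk hmin
  have hcθ := memLp_combo hfs θ
  have hsub (j : Fin M) : ∫ u, (fs j u - fs k u) * f u ∂P =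
      ∫ u, fs j u * f u ∂P - ∫ u, fs k u * f u ∂P := by
    simp only [sub_mul]
    exact integral_sub ((hfs j).integrable_mul hf) ((hfs k).integrable_mul hf)
  rw [Vreg_eq_of_sum_eq_one hfs ω hθ.2, Vreg_eq_of_sum_eq_one hfs ω hk.2, hck,
    (hfs k).integral_sub_sq hcθ] at hle
  have e1 : ∫ u, fs k u * combo fs θ u ∂P = ∑ j, θ j * ∫ u, fs j u * fs k u ∂P := by
    rw [← integral_combo_mul hfs θ (hfs k)]
    simp only [mul_comm]
  simp only [Pi.single_apply, ite_mul, one_mul, zero_mul, Finset.sum_ite_eq',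
    Finset.mem_univ, if_true] at hle
  rw [e1] at hle
  rw [hcθ.integral_sub_sq hf, (hfs k).integral_sub_sq hf, integral_combo_mul hfs θ hf]
  simp only [(hfs _).integral_sub_sq (hfs k), hsub]
  have e2 : ∀ a : Fin M → ℝ, ∀ c : ℝ, ∑ j, θ j * (c * a j) = c * ∑ j, θ j * a j := by
    intro a c
    rw [Finset.mul_sum]
    exact Finset.sum_congr rfl fun j _ => by ring
  simp only [sub_mul, mul_sub, mul_add, Finset.sum_sub_distrib, Finset.sum_add_distrib, e2,
    ← Finset.sum_mul, hθ.2, one_mul] at hle ⊢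
  linarith

end Quadratic

/-- sharp oracle inequality for the penalized procedure in regression
with known design (Section 3.4). Here `f` is the regression function
`f(x) = E[Y | X = x]`, expressed through the defining property of conditional
expectation on the σ-algebra generated by the design. -/
theorem regression_known_design_oracle_inequality :
    ∃ c : ℝ, 0 < c ∧
      ∀ (𝒳 : Type*) (_ : MeasurableSpace 𝒳) (ν : Measure (𝒳 × ℝ)),
        IsProbabilityMeasure ν →
      ∀ (M n : ℕ), 1 ≤ M → 1 ≤ n →
      ∀ (b : ℝ), 0 < b →
      ∀ f : 𝒳 → ℝ, Measurable f →
        (∀ A : Set 𝒳, MeasurableSet A →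
          (∫ p in Prod.fst ⁻¹' A, p.2 ∂ν) = ∫ p in Prod.fst ⁻¹' A, f p.1 ∂ν) →
      (∀ᵐ p ∂ν, |p.2| ≤ b) →
      ∀ fs : Fin M → 𝒳 → ℝ, (∀ j, Measurable (fs j)) →
        (∀ j, ∀ᵐ p ∂ν, |fs j p.1| ≤ b) →
      ∀ θhat : (Fin n → 𝒳 × ℝ) → Fin M → ℝ,
        (∀ ω, θhat ω ∈ stdSimplex ℝ (Fin M)) →
        (∀ ω, ∀ θ ∈ stdSimplex ℝ (Fin M),
          Vreg (ν.map Prod.fst) fs ω (θhat ω) ≤ Vreg (ν.map Prod.fst) fs ω θ) →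
      ∀ x : ℝ, 0 < x →
        (Measure.pi fun _ : Fin n => ν)
          {ω | (∫ u, (combo fs (θhat ω) u - f u) ^ 2 ∂(ν.map Prod.fst))
            ≤ (⨅ j, ∫ u, (fs j u - f u) ^ 2 ∂(ν.map Prod.fst))
              + c * b ^ 2 * (x + Real.log M) / (n : ℝ)}
          > ENNReal.ofReal (1 - Real.exp (-x)) := by
  refine ⟨16, by norm_num, ?_⟩
  intro 𝒳 _ ν _ M n hM hn b hb f hf hfY hY fs hfs hfsb θhat hθ hmin x hx
  have : Nonempty (Fin M) := ⟨⟨0, hM⟩⟩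
  have hfb := regressionFunction_abs_le hb.le hf hfY hY
  have memLp_of_bdd {g : 𝒳 → ℝ} (hg : Measurable g) (hgb : ∀ᵐ p ∂ν, |g p.1| ≤ b) :
      MemLp g 2 (ν.map Prod.fst) := by
    have : IsProbabilityMeasure (ν.map (Prod.fst : 𝒳 × ℝ → 𝒳)) :=
      Measure.isProbabilityMeasure_map measurable_fst.aemeasurable
    refine MemLp.of_bound hg.aestronglyMeasurable b ?_
    exact (ae_map_iff measurable_fst.aemeasurable
      (measurableSet_le hg.abs measurable_const)).2 hgb
  have hfsL (j : Fin M) := memLp_of_bdd (hfs j) (hfsb j)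
  have hfL := memLp_of_bdd hf hfb
  obtain ⟨k, hk⟩ := exists_eq_ciInf_of_finite
    (f := fun j => ∫ u, (fs j u - f u) ^ 2 ∂(ν.map Prod.fst))
  rw [← hk]
  set Z : Fin M → 𝒳 × ℝ → ℝ := fun j p => (fs j p.1 - fs k p.1) * p.2 with hZ
  set v : Fin M → ℝ := fun j => ∫ u, (fs j u - fs k u) ^ 2 ∂(ν.map Prod.fst) with hv
  have hΔm (j : Fin M) : Measurable fun u => fs j u - fs k u := (hfs j).sub (hfs k)
  have hZm (j : Fin M) : Measurable (Z j) := ((hΔm j).comp measurable_fst).mul measurable_snd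
  have hΔb (j : Fin M) : ∀ᵐ p ∂ν, |fs j p.1 - fs k p.1| ≤ 2 * b := by
    filter_upwards [hfsb j, hfsb k] with p h1 h2
    linarith [abs_sub (fs j p.1) (fs k p.1)]
  have hZb (j : Fin M) : ∀ᵐ p ∂ν, |Z j p| ≤ 2 * b ^ 2 := by
    filter_upwards [hΔb j, hY] with p h1 h2
    rw [abs_mul]
    calc _ ≤ 2 * b * b := mul_le_mul h1 h2 (abs_nonneg _) (by positivity)
      _ = 2 * b ^ 2 := by ring
  have hZmean (j : Fin M) : ∫ p, Z j p ∂ν = ∫ u, (fs j u - fs k u) * f u ∂(ν.map Prod.fst) :=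
    integral_mul_snd_eq_integral_mul_regressionFunction hb.le hf hfY hY (hΔm j) (hΔb j)
  have hZsq (j : Fin M) : ∫ p, Z j p ^ 2 ∂ν ≤ b ^ 2 * v j := by
    have hi : Integrable (fun p : 𝒳 × ℝ => (fs j p.1 - fs k p.1) ^ 2) ν :=
      (((hfsL j).sub (hfsL k)).integrable_sq).comp_measurable measurable_fst
    rw [hv]
    simp only
    rw [integral_map measurable_fst.aemeasurable ((hΔm j).pow_const 2).aestronglyMeasurable,
      ← integral_const_mul]
    refine integral_mono_of_nonneg (.of_forall fun p => sq_nonneg _) (hi.const_mul _) ?_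
    filter_upwards [hY] with p hp
    have : p.2 ^ 2 ≤ b ^ 2 := sq_le_sq' (neg_le_of_abs_le hp) (le_of_abs_le hp)
    simp only [hZ, mul_pow]
    rw [mul_comm]
    gcongr
  set U : Fin M → 𝒳 × ℝ → ℝ :=
    fun j p => (Z j p - ∫ p, Z j p ∂ν - v j / 4) / (4 * b ^ 2) with hU
  set t := 2 * x + Real.log M with ht
  have hM0 : (0 : ℝ) < M := by exact_mod_cast hM
  have hn0 : (0 : ℝ) < n := by exact_mod_cast hn
  set μ := Measure.pi fun _ : Fin n => ν
  set B : Set (Fin n → 𝒳 × ℝ) := ⋃ j, {ω | t ≤ ∑ i, U j (ω i)} with hB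
  have hBm : MeasurableSet B := by
    refine MeasurableSet.iUnion fun j => measurableSet_le measurable_const ?_
    have : Measurable (U j) := (((hZm j).sub_const _).sub_const _).div_const _
    fun_prop
  have hBle : μ.real B ≤ Real.exp (-(2 * x)) := by
    calc μ.real B ≤ ∑ j, μ.real {ω | t ≤ ∑ i, U j (ω i)} := measureReal_iUnion_fintype_le _
      _ ≤ ∑ _j : Fin M, Real.exp (-t) := by
        refine Finset.sum_le_sum fun j _ => ?_
        obtain ⟨h1, h2⟩ := integral_exp_le_one_of_bounded (hZm j) hb (hZb j) (hZsq j)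
        exact measureReal_pi_le_sum_le_exp_neg h1 h2 n t
      _ = Real.exp (-(2 * x)) := by
        rw [Finset.sum_const, Finset.card_univ, Fintype.card_fin, nsmul_eq_mul, ht, neg_add,
          Real.exp_add, Real.exp_neg (Real.log M), Real.exp_log hM0]
        field_simp
  have hsub : Bᶜ ⊆ {ω | (∫ u, (combo fs (θhat ω) u - f u) ^ 2 ∂(ν.map Prod.fst))
      ≤ (∫ u, (fs k u - f u) ^ 2 ∂(ν.map Prod.fst))
        + 16 * b ^ 2 * (x + Real.log M) / (n : ℝ)} := by
    intro ω hω
    simp only [hB, Set.compl_iUnion, Set.mem_iInter, Set.mem_compl_iff, Set.mem_ofPred_eq,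
      not_le] at hω
    refine (integral_combo_sub_sq_le_of_isMinOn hfsL hfL ω (hθ ω)
      (isMinOn_iff.2 (hmin ω)) k).trans (add_le_add_right ?_ _)
    calc _ ≤ ∑ j, θhat ω j * (16 * b ^ 2 * (x + Real.log M) / n) := by
          refine Finset.sum_le_sum fun j _ => mul_le_mul_of_nonneg_left ?_ ((hθ ω).1 j)
          have hsum : ∑ i, U j (ω i) =
              (∑ i, Z j (ω i) - n * ∫ p, Z j p ∂ν - n * (v j / 4)) / (4 * b ^ 2) := by
            simp [hU, ← Finset.sum_div, Finset.sum_sub_distrib]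
          have hlog : 0 ≤ Real.log M := Real.log_nonneg (by exact_mod_cast hM)
          calc _ = 8 * b ^ 2 / n * ∑ i, U j (ω i) := by
                rw [hsum, ← hZmean]
                field_simp
                ring
            _ ≤ 8 * b ^ 2 / n * (2 * (x + Real.log M)) := by
                gcongr
                linarith [hω j]
            _ = _ := by ring
      _ = _ := by rw [← Finset.sum_mul, (hθ ω).2, one_mul]
  refine lt_of_lt_of_le ?_ (measure_mono hsub)
  rw [← ofReal_measureReal, probReal_compl_eq_one_sub hBm]
  have hlt : Real.exp (-(2 * x)) < Real.exp (-x) := Real.exp_lt_exp.2 (by linarith)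
  have h1 : Real.exp (-x) < 1 := Real.exp_lt_one_iff.2 (by linarith)
  exact (ENNReal.ofReal_lt_ofReal_iff (by linarith)).2 (by linarith)
end
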